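/- There exists a continuous function h : [0,1]² → [0,1], nondecreasing in each coordinate, such that: (1) for all 0 ≤ τ_v ≤ θ_v ≤ 1, Φ1(τ_v,θ_v) ≥ 0.6; and (2) for all 0 ≤ τ_u ≤ θ_u ≤ 1 and all 1−θ_u ≤ τ_v ≤ θ_v ≤ 1, Φ2(τ_u,θ_u,τ_v,θ_v) ≥ 0.6. -/

import Mathlib

namespace PriceFunction

open Finset

/-! ### Rational bounds for logarithms -/

/-- Partial sum of `log r = 2 * artanh ((r - 1) / (r + 1))`. -/
def logSum (r : ℚ) : ℚ := 2 * ∑ i ∈ range 7, ((r - 1) / (r + 1)) ^ (2 * i + 1) / (2 * i + 1)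

/-- Remainder bound for `logSum`. -/
def logErr (r : ℚ) : ℚ := 2 * (((r - 1) / (r + 1)) ^ 15 / (1 - ((r - 1) / (r + 1)) ^ 2))

/-- A lower bound for `log r`, after at most `k` halvings of the argument. -/
def logLo : ℕ → ℚ → ℚ
  | 0, r => logSum r
  | k + 1, r => if r < 2 then logSum r else logSum 2 + logLo k (r / 2)

/-- An upper bound for `log r`, after at most `k` halvings of the argument. -/
def logHi : ℕ → ℚ → ℚ
  | 0, r => logSum r + logErr r
  | k + 1, r => if r < 2 then logSum r + logErr r else logSum 2 + logErr 2 + logHi k (r / 2)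

lemma logSum_bounds {r : ℚ} (hr : 1 ≤ r) :
    (logSum r : ℝ) ≤ Real.log r ∧ Real.log r ≤ (logSum r : ℝ) + logErr r := by
  have hr' : (1 : ℝ) ≤ r := by exact_mod_cast hr
  have h0 : (0 : ℝ) ≤ (r - 1) / (r + 1) := div_nonneg (by linarith) (by linarith)
  have h1 : ((r : ℝ) - 1) / (r + 1) < 1 := by rw [div_lt_one (by linarith)]; linarith
  have he : (1 + ((r : ℝ) - 1) / (r + 1)) / (1 - (r - 1) / (r + 1)) = r := by
    have : (r : ℝ) + 1 ≠ 0 := by linarith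
    field_simp
    ring
  have hlo := Real.sum_range_le_log_div h0 h1 7
  have hhi := Real.log_div_le_sum_range_add h0 h1 7
  rw [he] at hlo hhi
  constructor
  · simp only [logSum]; push_cast; linarith
  · simp only [logSum, logErr]; push_cast; norm_num at hhi ⊢; linarith

lemma logLo_le (k : ℕ) {r : ℚ} (hr : 1 ≤ r) : (logLo k r : ℝ) ≤ Real.log r := by
  induction k generalizing r with
  | zero => exact (logSum_bounds hr).1
  | succ k ih =>
    rw [logLo]
    split_ifs with h
    · exact (logSum_bounds hr).1
    · have h2 := (logSum_bounds (r := 2) (by norm_num)).1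
      have h3 := ih (r := r / 2) (by linarith)
      have hr0 : (r : ℝ) ≠ 0 := by
        have : (1 : ℝ) ≤ r := by exact_mod_cast hr
        linarith
      push_cast at h2 h3 ⊢
      rw [Real.log_div hr0 (by norm_num)] at h3
      linarith

lemma le_logHi (k : ℕ) {r : ℚ} (hr : 1 ≤ r) : Real.log r ≤ logHi k r := by
  induction k generalizing r with
  | zero => simpa [logHi] using (logSum_bounds hr).2
  | succ k ih =>
    rw [logHi]
    split_ifs with h
    · simpa using (logSum_bounds hr).2
    · have h2 := (logSum_bounds (r := 2) (by norm_num)).2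
      have h3 := ih (r := r / 2) (by linarith)
      have hr0 : (r : ℝ) ≠ 0 := by
        have : (1 : ℝ) ≤ r := by exact_mod_cast hr
        linarith
      push_cast at h2 h3 ⊢
      rw [Real.log_div hr0 (by norm_num)] at h3
      linarith

/-! ### The numerical data -/

/-- Breakpoints of the piecewise linear marginal. -/
def knot (i : ℕ) : ℚ :=
  [0, 49/1000, 84/1000, 111/1000, 137/1000, 185/1000, 214/1000, 254/1000, 290/1000, 316/1000,
    343/1000, 370/1000, 400/1000].getD i 0

/-- Thresholds of the logarithmic pieces. -/
def thr (i : ℕ) : ℚ :=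
  [35/1000, 78/1000, 123/1000, 159/1000, 223/1000, 258/1000, 270/1000, 308/1000, 331/1000,
    357/1000, 301/1000, 529/1000].getD i 1

/-- Weights of the logarithmic pieces. -/
def wt (i : ℕ) : ℚ :=
  [132/10000, 130/10000, 235/10000, 143/10000, 243/10000, 285/10000, 550/10000, 850/10000,
    852/10000, 1113/10000, 457/10000, 502/10000].getD i 0

/-- Points beyond which `log (y / rho)` dominates the first `i` logarithmic pieces. -/
def cross (i : ℕ) : ℚ :=
  [38228/100000, 39470/100000, 40334/100000, 41536/100000, 42150/100000, 42871/100000,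
    43579/100000, 44987/100000, 46979/100000, 49158/100000, 52465/100000, 55193/100000,
    55454/100000].getD i 0

/-- Points of tangency. -/
def tpt (i : ℕ) : ℚ :=
  [245/10000, 665/10000, 975/10000, 1240/10000, 1610/10000, 1995/10000, 2340/10000, 2720/10000,
    3030/10000, 3295/10000, 3565/10000, 3850/10000, 4200/10000].getD i 1

/-- Points of tangency of the quadratic terms, in relative position. -/
def rpt (i : ℕ) : ℚ :=
  [70/100, 20/100, 75/100, 25/100, 30/100, 75/100, 30/100, 60/100, 45/100, 50/100, 0, 1].getD i 0

/-- The point where the limiting profile becomes positive. -/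
def rho : ℚ := 382271 / 1000000

/-- The total weight. -/
def tot : ℚ := 5492 / 10000

/-- Partial sums of the weights. -/
def cum (i : ℕ) : ℚ := ∑ j ∈ range i, wt j

/-- Value at `b` of the tangent line at `tpt i`, bounding the piece `j` from below. -/
def tanVal (i j : ℕ) (b : ℚ) : ℚ :=
  if thr j ≤ tpt i then b * logLo 4 (tpt i / thr j) - tpt i + thr j else 0

/-- Left end value of the affine lower bound for the piece `j` over the ramp `i`. -/
def endL (i j : ℕ) : ℚ :=
  if j < i then 2 / 5 - thr j + tanVal i j (knot i)
  else if j = i then (1 - rpt i ^ 2) * (knot (i + 1) - knot i) / 2 + 2 / 5 - knot (i + 1)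
  else 2 / 5 - (knot j + knot (j + 1)) / 2

/-- Right end value of the affine lower bound for the piece `j` over the ramp `i`. -/
def endR (i j : ℕ) : ℚ :=
  if j < i then 2 / 5 - thr j + tanVal i j (knot (i + 1))
  else if j = i then knot i - thr i + (1 + 2 * rpt i - rpt i ^ 2) * (knot (i + 1) - knot i) / 2
    + 2 / 5 - knot (i + 1)
  else 2 / 5 - (knot j + knot (j + 1)) / 2

lemma knot_lt : ∀ i < 12, knot i < knot (i + 1) := by decide +kernel

lemma thr_pos : ∀ j < 12, 0 < thr j ∧ thr j ≤ 3 / 5 := by decide +kernel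

lemma wt_nonneg : ∀ j < 12, 0 ≤ wt j := by decide +kernel

lemma cum_last : cum 12 = tot := by decide +kernel

lemma cross_bounds : ∀ i < 13, rho ≤ cross i ∧ cross i ≤ 3 / 5 := by decide +kernel

lemma knot_le_cross : ∀ i < 12, knot (i + 1) ≤ cross i ∧ knot (i + 1) ≤ cross (i + 1) := by
  decide +kernel

lemma cross_check : ∀ i < 13,
    ∑ j ∈ range i, wt j * logHi 4 (max (cross i) (thr j) / thr j) ≤ logLo 4 (cross i / rho) := by
  decide +kernel

lemma slope_check : ∀ i < 12,
    (cum i ≤ knot i ∧ cum (i + 1) ≤ knot (i + 1)) ∨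
    (2 / 5 - knot i ≤ 3 / 5 * (tot - cum i) ∧
      2 / 5 - knot (i + 1) ≤ 3 / 5 * (tot - cum (i + 1))) := by
  decide +kernel

lemma total_check :
    2 / 5 - 3 / 5 * tot ≤ ∑ j ∈ range 12, wt j * (2 / 5 - (knot j + knot (j + 1)) / 2) := by
  decide +kernel

lemma left_check : ∀ i < 12,
    1 / 5 ≤ ∑ j ∈ range i, wt j * (cross i - thr j + tanVal i j (knot i)) + 3 / 5 - cross i := by
  decide +kernel

lemma right_check : ∀ i < 12,
    1 / 5 ≤ ∑ j ∈ range (i + 1), wt j * (cross (i + 1) - thr j) +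
      ∑ j ∈ range i, wt j * tanVal i j (knot (i + 1)) + 3 / 5 - cross (i + 1) := by
  decide +kernel

lemma end_check : ∀ i < 12,
    2 / 5 - 3 / 5 * tot ≤ ∑ j ∈ range 12, wt j * endL i j ∧
    2 / 5 - 3 / 5 * tot ≤ ∑ j ∈ range 12, wt j * endR i j := by
  decide +kernel

lemma upper_check :
    1 / 5 ≤ ∑ j ∈ range 12, wt j * (cross 12 - thr j + tanVal 12 j (2 / 5)) + 3 / 5 - cross 12 := by
  decide +kernel

/-! ### The gain functional -/

/-- `θ * f θ - ∫ f` over `[a, θ]`. -/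
noncomputable def gain (f : ℝ → ℝ) (a θ : ℝ) : ℝ := θ * f θ - ∫ y in a..θ, f y

lemma gain_add {f g : ℝ → ℝ} (hf : Continuous f) (hg : Continuous g) (a θ : ℝ) :
    gain (fun y => f y + g y) a θ = gain f a θ + gain g a θ := by
  simp only [gain]
  rw [intervalIntegral.integral_add (hf.intervalIntegrable _ _) (hg.intervalIntegrable _ _)]
  ring

lemma gain_const_mul (k : ℝ) (f : ℝ → ℝ) (a θ : ℝ) :
    gain (fun y => k * f y) a θ = k * gain f a θ := by
  simp only [gain, intervalIntegral.integral_const_mul]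
  ring

lemma gain_sum {s : Finset ℕ} {f : ℕ → ℝ → ℝ} (hf : ∀ j ∈ s, Continuous (f j)) (a θ : ℝ) :
    gain (fun y => ∑ j ∈ s, f j y) a θ = ∑ j ∈ s, gain (f j) a θ := by
  simp only [gain, sum_sub_distrib, mul_sum]
  rw [intervalIntegral.integral_finsetSum fun j hj => (hf j hj).intervalIntegrable _ _]

lemma mul_le_gain {f : ℝ → ℝ} (hf : Continuous f) (hm : Monotone f) {a θ : ℝ} (h : a ≤ θ) :
    a * f θ ≤ gain f a θ := by
  have : ∫ y in a..θ, f y ≤ ∫ _ in a..θ, f θ :=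
    intervalIntegral.integral_mono_on h (hf.intervalIntegrable _ _)
      (continuous_const.intervalIntegrable _ _) fun y hy => hm hy.2
  rw [intervalIntegral.integral_const, smul_eq_mul] at this
  rw [gain]
  linarith

lemma gain_le_gain {f g : ℝ → ℝ} (hf : Continuous f) (hg : Continuous g) {a θ : ℝ} (h : a ≤ θ)
    (hfg : ∀ y ∈ Set.Icc a θ, f y ≤ g y) (he : f θ = g θ) : gain g a θ ≤ gain f a θ := by
  have : ∫ y in a..θ, f y ≤ ∫ y in a..θ, g y :=
    intervalIntegral.integral_mono_on h (hf.intervalIntegrable _ _)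
      (hg.intervalIntegrable _ _) hfg
  rw [gain, gain, he]
  linarith

lemma gain_congr {f g : ℝ → ℝ} {a θ : ℝ} (h : a ≤ θ) (hfg : ∀ y ∈ Set.Icc a θ, f y = g y) :
    gain f a θ = gain g a θ := by
  rw [gain, gain, hfg θ ⟨h, le_rfl⟩, intervalIntegral.integral_congr]
  rwa [Set.uIcc_of_le h]

lemma gain_split {f : ℝ → ℝ} (hf : Continuous f) (a b c : ℝ) :
    gain f a c = gain f a b + gain f b c - b * f b := by
  simp only [gain]
  rw [← intervalIntegral.integral_add_adjacent_intervals
    (hf.intervalIntegrable a b) (hf.intervalIntegrable b c)]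
  ring

lemma gain_self (f : ℝ → ℝ) (a : ℝ) : gain f a a = a * f a := by simp [gain]

/-! ### Truncated logarithms -/

/-- The function `y ↦ log (max y t / t)`. -/
noncomputable def logTail (t y : ℝ) : ℝ := Real.log (max y t / t)

/-- The primitive of `logTail t` vanishing at `t`. -/
noncomputable def dev (t y : ℝ) : ℝ := y * logTail t y - max y t + t

section
variable {t : ℝ} (ht : 0 < t)
include ht

lemma logTail_of_le {y : ℝ} (h : y ≤ t) : logTail t y = 0 := by
  rw [logTail, max_eq_right h, div_self ht.ne', Real.log_one]

lemma one_le_max_div (y : ℝ) : 1 ≤ max y t / t := by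
  rw [one_le_div ht]
  exact le_max_right _ _

lemma logTail_nonneg (y : ℝ) : 0 ≤ logTail t y := Real.log_nonneg (one_le_max_div ht y)

lemma logTail_mono : Monotone (logTail t) := fun x y h =>
  Real.log_le_log (by linarith [one_le_max_div ht x])
    (div_le_div_of_nonneg_right (max_le_max_right t h) ht.le)

lemma continuous_logTail : Continuous (logTail t) :=
  Continuous.log (by fun_prop) fun y => by linarith [one_le_max_div ht y]

lemma logTail_sub_le {x y : ℝ} (hx : 0 < x) (h : x ≤ y) :
    logTail t y - logTail t x ≤ Real.log (y / x) := by
  have h1 : 0 < max x t := lt_max_of_lt_left hx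
  have h2 : 0 < max y t := lt_max_of_lt_right ht
  rw [logTail, logTail, Real.log_div h2.ne' ht.ne', Real.log_div h1.ne' ht.ne',
    sub_sub_sub_cancel_right, ← Real.log_div h2.ne' h1.ne']
  refine Real.log_le_log (by positivity) ?_
  rw [div_le_div_iff₀ h1 hx]
  rcases le_total x t with hxt | hxt
  · rw [max_eq_right hxt]
    rcases le_total y t with hyt | hyt
    · rw [max_eq_right hyt]; nlinarith
    · rw [max_eq_left hyt]; nlinarith
  · rw [max_eq_left hxt, max_eq_left (hxt.trans h)]

lemma logTail_sub_of_le {x y : ℝ} (hx : t ≤ x) (h : x ≤ y) :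
    logTail t y - logTail t x = Real.log (y / x) := by
  have h1 : 0 < x := ht.trans_le hx
  rw [logTail, logTail, max_eq_left hx, max_eq_left (hx.trans h),
    Real.log_div (h1.trans_le h).ne' ht.ne', Real.log_div h1.ne' ht.ne',
    sub_sub_sub_cancel_right, ← Real.log_div (h1.trans_le h).ne' h1.ne']

lemma logTail_sub_le_div {x y : ℝ} (hx : 0 < x) (h : x ≤ y) :
    logTail t y - logTail t x ≤ (y - x) / x := by
  refine (logTail_sub_le ht hx h).trans ?_
  have := Real.log_le_sub_one_of_pos (div_pos (hx.trans_le h) hx)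
  rwa [sub_div, div_self hx.ne']

lemma integral_logTail {a b : ℝ} (h : a ≤ b) :
    ∫ y in a..b, logTail t y = dev t b - dev t a := by
  have hc := continuous_logTail ht
  refine MeasureTheory.integral_eq_of_hasDerivAt_off_countable_of_le (dev t) (logTail t) h
    (Set.countable_singleton t) ?_ ?_ (hc.intervalIntegrable _ _)
  · unfold dev
    fun_prop
  · rintro x ⟨-, hx⟩
    rcases lt_or_gt_of_ne (show x ≠ t from hx) with hx | hx
    · rw [logTail_of_le ht hx.le]
      refine (hasDerivAt_const x (0 : ℝ)).congr_of_eventuallyEq ?_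
      filter_upwards [eventually_lt_nhds hx] with y hy
      rw [dev, logTail_of_le ht hy.le, max_eq_right hy.le]
      ring
    · have hx0 : 0 < x := ht.trans hx
      have hd : HasDerivAt (fun y => y * Real.log (y / t) - y + t) (Real.log (x / t)) x := by
        have h1 : HasDerivAt (fun y => Real.log (y / t)) (1 / t / (x / t)) x :=
          ((hasDerivAt_id x).div_const t).log (div_pos hx0 ht).ne'
        have h2 := (((hasDerivAt_id x).mul h1).sub (hasDerivAt_id x)).add_const t
        refine h2.congr_deriv ?_
        simp only [id]
        field_simp
        ring
      rw [logTail, max_eq_left hx.le]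
      refine hd.congr_of_eventuallyEq ?_
      filter_upwards [eventually_gt_nhds hx] with y hy
      rw [dev, logTail, max_eq_left hy.le]

lemma gain_logTail {a b : ℝ} (h : a ≤ b) : gain (logTail t) a b = max b t - t + dev t a := by
  rw [gain, integral_logTail ht h, dev]
  ring

lemma tangent_le_dev {m b : ℝ} (hm : t ≤ m) (hb : 0 ≤ b) :
    b * Real.log (m / t) - m + t ≤ dev t b := by
  have hm0 : 0 < m := ht.trans_le hm
  have h0 : 0 < max b t := lt_max_of_lt_right ht
  have h1 := Real.log_le_sub_one_of_pos (div_pos hm0 h0)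
  have h2 : Real.log (m / t) = logTail t b + Real.log (m / max b t) := by
    rw [logTail, ← Real.log_mul (div_pos h0 ht).ne' (div_pos hm0 h0).ne']
    congr 1
    field_simp
  have h3 : b * (m / max b t - 1) ≤ m - max b t := by
    have : m - max b t = max b t * (m / max b t - 1) := by field_simp
    rcases le_total b t with hbt | hbt
    · rw [this]
      refine mul_le_mul_of_nonneg_right (le_max_left _ _) ?_
      rw [max_eq_right hbt, sub_nonneg, one_le_div ht]
      exact hm
    · rw [this, max_eq_left hbt]
  rw [dev, h2]
  nlinarith [mul_le_mul_of_nonneg_left h1 hb]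

lemma dev_nonneg {b : ℝ} (hb : 0 ≤ b) : 0 ≤ dev t b := by
  simpa [ht.ne'] using tangent_le_dev ht le_rfl hb

end

/-! ### Profiles -/

lemma rho_pos : (0 : ℝ) < rho := by norm_num [rho]

lemma thr_pos' {j : ℕ} (hj : j < 12) : (0 : ℝ) < thr j := by exact_mod_cast (thr_pos j hj).1

lemma wt_nonneg' {j : ℕ} (hj : j < 12) : (0 : ℝ) ≤ wt j := by exact_mod_cast wt_nonneg j hj

/-- Weighted combination of the logarithmic pieces. -/
noncomputable def mix (w : ℕ → ℝ) (y : ℝ) : ℝ := ∑ j ∈ range 12, w j * logTail (thr j) y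

/-- The profile `mix w`, raised to the limiting profile. -/
noncomputable def row (w : ℕ → ℝ) (y : ℝ) : ℝ := max (mix w y) (logTail rho y)

lemma continuous_logTail_thr {j : ℕ} (hj : j < 12) : Continuous (logTail (thr j)) :=
  continuous_logTail (thr_pos' hj)

lemma continuous_logTail_rho : Continuous (logTail rho) := continuous_logTail rho_pos

lemma continuous_mix (w : ℕ → ℝ) : Continuous (mix w) :=
  continuous_finsetSum _ fun _ hj => continuous_const.mul
    (continuous_logTail_thr (mem_range.1 hj))

lemma continuous_row (w : ℕ → ℝ) : Continuous (row w) :=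
  (continuous_mix w).max continuous_logTail_rho

lemma logTail_le_row (w : ℕ → ℝ) (y : ℝ) : logTail rho y ≤ row w y := le_max_right _ _

lemma row_nonneg (w : ℕ → ℝ) (y : ℝ) : 0 ≤ row w y :=
  (logTail_nonneg rho_pos y).trans (logTail_le_row w y)

lemma mix_le_mix {w w' : ℕ → ℝ} (h : ∀ j < 12, w j ≤ w' j) (y : ℝ) : mix w y ≤ mix w' y :=
  sum_le_sum fun j hj => mul_le_mul_of_nonneg_right (h j (mem_range.1 hj))
    (logTail_nonneg (thr_pos' (mem_range.1 hj)) y)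

lemma row_le_row {w w' : ℕ → ℝ} (h : ∀ j < 12, w j ≤ w' j) (y : ℝ) : row w y ≤ row w' y :=
  max_le_max_right _ (mix_le_mix h y)

section
variable {w : ℕ → ℝ} (hw : ∀ j < 12, 0 ≤ w j)
include hw

lemma mix_nonneg (y : ℝ) : 0 ≤ mix w y :=
  sum_nonneg fun j hj => mul_nonneg (hw j (mem_range.1 hj))
    (logTail_nonneg (thr_pos' (mem_range.1 hj)) y)

lemma mix_mono : Monotone (mix w) := fun _ _ h =>
  sum_le_sum fun j hj => mul_le_mul_of_nonneg_left
    (logTail_mono (thr_pos' (mem_range.1 hj)) h) (hw j (mem_range.1 hj))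

lemma row_mono : Monotone (row w) := fun _ _ h =>
  max_le_max (mix_mono hw h) (logTail_mono rho_pos h)

variable (hs : ∑ j ∈ range 12, w j ≤ 1)
include hs

lemma mix_sub_le {x y : ℝ} (hx : rho ≤ x) (h : x ≤ y) :
    mix w y - mix w x ≤ logTail rho y - logTail rho x := by
  have hx0 : 0 < x := rho_pos.trans_le hx
  rw [logTail_sub_of_le rho_pos hx h, mix, mix, ← sum_sub_distrib]
  have hl : 0 ≤ Real.log (y / x) := Real.log_nonneg ((one_le_div hx0).2 h)
  calc ∑ j ∈ range 12, (w j * logTail (thr j) y - w j * logTail (thr j) x)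
      ≤ ∑ j ∈ range 12, w j * Real.log (y / x) := sum_le_sum fun j hj => by
        rw [← mul_sub]
        exact mul_le_mul_of_nonneg_left (logTail_sub_le (thr_pos' (mem_range.1 hj)) hx0 h)
          (hw j (mem_range.1 hj))
    _ ≤ Real.log (y / x) := by
        rw [← sum_mul]
        exact mul_le_of_le_one_left hl hs

lemma row_eq_of_le {x y : ℝ} (hx : rho ≤ x) (hd : mix w x ≤ logTail rho x) (h : x ≤ y) :
    row w y = logTail rho y :=
  max_eq_right (by linarith [mix_sub_le hw hs hx h])

lemma excess_mono : Monotone fun y => row w y - mix w y := fun x y h => by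
  have he (z : ℝ) : row w z - mix w z = max 0 (logTail rho z - mix w z) := by
    rw [row, ← max_sub_sub_right, sub_self]
  simp only [he]
  refine max_le (le_max_left _ _) ?_
  rcases le_total x rho with hxr | hxr
  · refine le_max_of_le_left ?_
    rw [logTail_of_le rho_pos hxr]
    linarith [mix_nonneg hw x]
  · refine le_max_of_le_right ?_
    linarith [mix_sub_le hw hs hxr h]

lemma le_gain_row {b c : ℝ} (hb : 0 ≤ b) (h : b ≤ c) :
    ∑ j ∈ range 12, w j * (c - thr j + dev (thr j) b) ≤ gain (row w) b c := by
  have h1 : gain (row w) b c = gain (mix w) b c + gain (fun y => row w y - mix w y) b c := by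
    rw [← gain_add (continuous_mix w) (g := fun y => row w y - mix w y)
      ((continuous_row w).sub (continuous_mix w))]
    simp
  have h2 : 0 ≤ gain (fun y => row w y - mix w y) b c :=
    (mul_nonneg hb (sub_nonneg.2 (le_max_left _ _))).trans
      (mul_le_gain ((continuous_row w).sub (continuous_mix w)) (excess_mono hw hs) h)
  have h3 : gain (mix w) b c = ∑ j ∈ range 12, w j * gain (logTail (thr j)) b c := by
    simp only [← gain_const_mul]
    exact gain_sum (fun j hj => continuous_const.mul
      (continuous_logTail_thr (mem_range.1 hj))) b c
  rw [h1, h3]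
  refine (sum_le_sum fun j hj => ?_).trans (le_add_of_nonneg_right h2)
  refine mul_le_mul_of_nonneg_left ?_ (hw j (mem_range.1 hj))
  rw [gain_logTail (thr_pos' (mem_range.1 hj)) h]
  linarith [le_max_left c (thr j : ℝ)]

lemma gain_row_of_le (b : ℝ) {x c : ℝ} (hx : rho ≤ x) (hd : mix w x ≤ logTail rho x) (h : x ≤ c) :
    gain (row w) b c = gain (row w) b x + (c - x) := by
  rw [gain_split (continuous_row w) b x c,
    gain_congr h fun y hy => row_eq_of_le hw hs hx hd hy.1, gain_logTail rho_pos h,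
    row_eq_of_le hw hs hx hd le_rfl, dev, max_eq_left hx, max_eq_left (hx.trans h)]
  ring

lemma le_gain_row_of_le {b x c : ℝ} (hb : 0 ≤ b) (hbx : b ≤ x) (hx : rho ≤ x)
    (hd : mix w x ≤ logTail rho x) (h : x ≤ c) :
    ∑ j ∈ range 12, w j * (x - thr j + dev (thr j) b) + (c - x) ≤ gain (row w) b c := by
  rw [gain_row_of_le hw hs b hx hd h]
  linarith [le_gain_row hw hs hb hbx]

end

/-! ### The marginal weights -/

/-- The piecewise linear function rising from `0` to `1` over `[knot i, knot (i + 1)]`. -/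
noncomputable def ramp (i : ℕ) (τ : ℝ) : ℝ :=
  max 0 (min 1 ((τ - knot i) / (knot (i + 1) - knot i)))

/-- The weight of the piece `j` at `τ`. -/
noncomputable def weight (τ : ℝ) (j : ℕ) : ℝ := wt j * ramp j τ

/-- The total weight at `τ`. -/
noncomputable def marg (τ : ℝ) : ℝ := ∑ j ∈ range 12, weight τ j

lemma knot_lt' {i : ℕ} (hi : i < 12) : (knot i : ℝ) < knot (i + 1) := by
  exact_mod_cast knot_lt i hi

lemma knot_le {i j : ℕ} (hij : i ≤ j) (hj : j ≤ 12) : (knot i : ℝ) ≤ knot j := by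
  induction j, hij using Nat.le_induction with
  | base => exact le_rfl
  | succ n _ ih => exact (ih (by omega)).trans (knot_lt' (by omega)).le

lemma knot_zero : (knot 0 : ℝ) = 0 := by norm_num [knot]

lemma knot_last : (knot 12 : ℝ) = 2 / 5 := by norm_num [knot]

lemma ramp_nonneg (i : ℕ) (τ : ℝ) : 0 ≤ ramp i τ := le_max_left _ _

lemma ramp_le_one (i : ℕ) (τ : ℝ) : ramp i τ ≤ 1 := max_le zero_le_one (min_le_left _ _)

lemma continuous_ramp (i : ℕ) : Continuous (ramp i) := by
  unfold ramp
  fun_prop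

section
variable {i : ℕ} (hi : i < 12)
include hi

lemma ramp_mono : Monotone (ramp i) := fun x y h =>
  max_le_max_left _ (min_le_min_left _ (div_le_div_of_nonneg_right (by linarith)
    (sub_pos.2 (knot_lt' hi)).le))

lemma ramp_of_le {τ : ℝ} (h : τ ≤ knot i) : ramp i τ = 0 :=
  max_eq_left (min_le_of_right_le (div_nonpos_of_nonpos_of_nonneg (by linarith)
    (sub_pos.2 (knot_lt' hi)).le))

lemma ramp_of_ge {τ : ℝ} (h : knot (i + 1) ≤ τ) : ramp i τ = 1 := by
  rw [ramp, min_eq_left, max_eq_right zero_le_one]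
  rw [one_le_div (sub_pos.2 (knot_lt' hi))]
  linarith

lemma ramp_combo {l : ℝ} (h0 : 0 ≤ l) (h1 : l ≤ 1) :
    ramp i ((1 - l) * knot i + l * knot (i + 1)) = l := by
  have := (sub_pos.2 (knot_lt' hi)).ne'
  have he : ((1 - l) * knot i + l * knot (i + 1) - knot i) / (knot (i + 1) - knot i) = l := by
    field_simp
    ring
  rw [ramp, he, min_eq_right h1, max_eq_right h0]

end

lemma exists_ramp_eq {b : ℝ} (h0 : 0 ≤ b) (h1 : b ≤ 2 / 5) :
    ∃ i < 12, ∃ l : ℝ, 0 ≤ l ∧ l ≤ 1 ∧ b = (1 - l) * knot i + l * knot (i + 1) ∧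
      ∀ j < 12, ramp j b = if j < i then 1 else if j = i then l else 0 := by
  obtain ⟨i, hi, hl, hr⟩ : ∃ i < 12, (knot i : ℝ) ≤ b ∧ b ≤ knot (i + 1) := by
    by_contra! h
    have key : ∀ n ≤ 12, (knot n : ℝ) ≤ b := fun n => by
      induction n with
      | zero => intro; rwa [knot_zero]
      | succ n ih => intro hn; exact (h n (by omega) (ih (by omega))).le
    have := h 11 (by norm_num) (key 11 (by norm_num))
    norm_num [knot_last] at this
    linarith
  have hd := sub_pos.2 (knot_lt' hi)
  have hb : b = (1 - (b - knot i) / (knot (i + 1) - knot i)) * knot i +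
      (b - knot i) / (knot (i + 1) - knot i) * knot (i + 1) := by
    field_simp
    ring
  have hl0 : 0 ≤ (b - knot i) / (knot (i + 1) - knot i) := div_nonneg (by linarith) hd.le
  have hl1 : (b - knot i) / (knot (i + 1) - knot i) ≤ 1 := by
    rw [div_le_one hd]
    linarith
  refine ⟨i, hi, _, hl0, hl1, hb, fun j hj => ?_⟩
  split_ifs with h h
  · exact ramp_of_ge hj ((knot_le (Nat.succ_le_of_lt h) hi.le).trans hl)
  · rw [h]
    nth_rw 1 [hb]
    exact ramp_combo hi hl0 hl1
  · exact ramp_of_le hj (hr.trans (knot_le (by omega) hj.le))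

lemma weight_nonneg (τ : ℝ) : ∀ j < 12, 0 ≤ weight τ j := fun j hj =>
  mul_nonneg (wt_nonneg' hj) (ramp_nonneg j τ)

lemma weight_le (τ : ℝ) : ∀ j < 12, weight τ j ≤ wt j := fun j hj =>
  mul_le_of_le_one_right (wt_nonneg' hj) (ramp_le_one j τ)

lemma weight_mono {x y : ℝ} (h : x ≤ y) : ∀ j < 12, weight x j ≤ weight y j := fun _ hj =>
  mul_le_mul_of_nonneg_left (ramp_mono hj h) (wt_nonneg' hj)

lemma weight_of_ge {τ : ℝ} (h : 2 / 5 ≤ τ) : ∀ j < 12, weight τ j = wt j := fun j hj => by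
  rw [weight, ramp_of_ge hj, mul_one]
  exact (knot_le hj le_rfl).trans (knot_last.trans_le h)

lemma sum_wt : ∑ j ∈ range 12, (wt j : ℝ) = tot := by exact_mod_cast cum_last

lemma tot_eq : (tot : ℝ) = 0.5492 := by norm_num [tot]

lemma sum_le_one {w : ℕ → ℝ} (h : ∀ j < 12, w j ≤ wt j) : ∑ j ∈ range 12, w j ≤ 1 :=
  (sum_le_sum fun j hj => h j (mem_range.1 hj)).trans (by rw [sum_wt, tot_eq]; norm_num)

lemma marg_nonneg (τ : ℝ) : 0 ≤ marg τ := sum_nonneg fun j hj => weight_nonneg τ j (mem_range.1 hj)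

lemma marg_le (τ : ℝ) : marg τ ≤ tot :=
  (sum_le_sum fun j hj => weight_le τ j (mem_range.1 hj)).trans_eq sum_wt

lemma marg_mono : Monotone marg := fun _ _ h =>
  sum_le_sum fun j hj => weight_mono h j (mem_range.1 hj)

lemma marg_of_ge {τ : ℝ} (h : 2 / 5 ≤ τ) : marg τ = tot := by
  rw [← sum_wt]
  exact sum_congr rfl fun j hj => weight_of_ge h j (mem_range.1 hj)

lemma continuous_weight (j : ℕ) : Continuous fun τ => weight τ j :=
  continuous_const.mul (continuous_ramp j)

lemma continuous_marg : Continuous marg :=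
  continuous_finsetSum _ fun j _ => continuous_weight j

/-- The weights of the first `i` pieces. -/
def cutWt (i j : ℕ) : ℝ := if j < i then wt j else 0

lemma cutWt_nonneg (i : ℕ) : ∀ j < 12, 0 ≤ cutWt i j := fun j hj => by
  unfold cutWt
  split_ifs
  exacts [wt_nonneg' hj, le_rfl]

lemma cutWt_le (i : ℕ) : ∀ j < 12, cutWt i j ≤ wt j := fun j hj => by
  unfold cutWt
  split_ifs
  exacts [le_rfl, wt_nonneg' hj]

lemma sum_cutWt {i : ℕ} (hi : i ≤ 12) (f : ℕ → ℝ) :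
    ∑ j ∈ range 12, cutWt i j * f j = ∑ j ∈ range i, wt j * f j := by
  rw [← sum_subset (range_mono hi) fun j _ hj => ?_]
  · exact sum_congr rfl fun j hj => by rw [cutWt, if_pos (mem_range.1 hj)]
  · rw [cutWt, if_neg (by simpa using hj), zero_mul]

lemma weight_eq_combo {i : ℕ} {b l : ℝ}
    (hr : ∀ j < 12, ramp j b = if j < i then 1 else if j = i then l else 0) :
    ∀ j < 12, weight b j = (1 - l) * cutWt i j + l * cutWt (i + 1) j := fun j hj => by
  rw [weight, hr j hj, cutWt, cutWt]
  rcases lt_trichotomy j i with h | h | h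
  · rw [if_pos h, if_pos h, if_pos (by omega)]; ring
  · rw [if_neg (by omega), if_pos h, if_neg (by omega), if_pos (by omega)]; ring
  · rw [if_neg (by omega), if_neg (by omega), if_neg (by omega), if_neg (by omega)]; ring

lemma cross_bounds' {i : ℕ} (hi : i < 13) : (rho : ℝ) ≤ cross i ∧ (cross i : ℝ) ≤ 3 / 5 := by
  obtain ⟨h1, h2⟩ := cross_bounds i hi
  refine ⟨by exact_mod_cast h1, ?_⟩
  have : (cross i : ℝ) ≤ (3 / 5 : ℚ) := by exact_mod_cast h2
  simpa using this

lemma mix_cutWt_le {i : ℕ} (hi : i < 13) : mix (cutWt i) (cross i) ≤ logTail rho (cross i) := by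
  obtain ⟨h1, h2⟩ := cross_bounds i hi
  have hr : 0 < rho := by norm_num [rho]
  rw [mix, sum_cutWt (by omega)]
  have hlo := logLo_le 4 ((one_le_div hr).2 h1)
  have hc : ((∑ j ∈ range i, wt j * logHi 4 (max (cross i) (thr j) / thr j) : ℚ) : ℝ) ≤
      (logLo 4 (cross i / rho) : ℚ) := by exact_mod_cast cross_check i hi
  push_cast at hc hlo
  rw [logTail, max_eq_left (cross_bounds' hi).1]
  refine le_trans (sum_le_sum fun j hj => ?_) (hc.trans hlo)
  have hj' : j < 12 := by have := mem_range.1 hj; omega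
  refine mul_le_mul_of_nonneg_left ?_ (wt_nonneg' hj')
  have := le_logHi 4 ((one_le_div (thr_pos j hj').1).2 (le_max_right (cross i) (thr j)))
  rw [logTail]
  push_cast at this
  exact this

section
variable {w : ℕ → ℝ} (hw : ∀ j < 12, 0 ≤ w j) (hw' : ∀ j < 12, w j ≤ wt j)
include hw'

lemma mix_cross_last_le : mix w (cross 12) ≤ logTail rho (cross 12) :=
  (mix_le_mix (fun j hj => by simpa [cutWt, hj] using hw' j hj) _).trans
    (mix_cutWt_le (by norm_num : 12 < 13))

include hw

lemma row_eq_of_cross_le {y : ℝ} (h : cross 12 ≤ y) : row w y = logTail rho y :=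
  row_eq_of_le hw (sum_le_one hw') (cross_bounds' (by norm_num)).1 (mix_cross_last_le hw') h

lemma row_last : row w (3 / 5) = logTail rho (3 / 5) :=
  row_eq_of_cross_le hw hw' (cross_bounds' (by norm_num)).2

end

lemma tanVal_combo_le {i j : ℕ} (hj : j < 12) {p q : ℚ} {b l : ℝ}
    (h0 : 0 ≤ (1 - l) * p + l * q) (hb : (1 - l) * p + l * q ≤ b) :
    (1 - l) * tanVal i j p + l * tanVal i j q ≤ dev (thr j) b := by
  unfold tanVal
  split_ifs with h
  · have hlo := logLo_le 4 ((one_le_div (thr_pos j hj).1).2 h)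
    have hh : (thr j : ℝ) ≤ tpt i := by exact_mod_cast h
    have h1 := tangent_le_dev (thr_pos' hj) hh (h0.trans hb)
    have h2 : 0 ≤ Real.log (tpt i / thr j) := Real.log_nonneg ((one_le_div (thr_pos' hj)).2 hh)
    push_cast at hlo ⊢
    have h3 := mul_le_mul_of_nonneg_left hlo h0
    have h4 := mul_le_mul_of_nonneg_right hb h2
    linarith
  · simpa using dev_nonneg (thr_pos' hj) (h0.trans hb)

/-! ### Gains of the profiles -/

lemma row_combo_le {w u v : ℕ → ℝ} {l : ℝ} (hw : ∀ j < 12, w j = (1 - l) * u j + l * v j)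
    (h0 : 0 ≤ l) (h1 : l ≤ 1) (y : ℝ) : row w y ≤ (1 - l) * row u y + l * row v y := by
  have hm : mix w y = (1 - l) * mix u y + l * mix v y := by
    simp only [mix, mul_sum, ← sum_add_distrib]
    exact sum_congr rfl fun j hj => by rw [hw j (mem_range.1 hj)]; ring
  have h1' : 0 ≤ 1 - l := by linarith
  refine max_le ?_ ?_
  · rw [hm]
    exact add_le_add (mul_le_mul_of_nonneg_left (le_max_left _ _) h1')
      (mul_le_mul_of_nonneg_left (le_max_left _ _) h0)
  · linarith [mul_le_mul_of_nonneg_left (logTail_le_row u y) h1',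
      mul_le_mul_of_nonneg_left (logTail_le_row v y) h0]

lemma le_gain_row_cutWt {i : ℕ} (hi : i < 13) {b : ℝ} (hb : 0 ≤ b) (hc : b ≤ cross i) :
    ∑ j ∈ range i, wt j * ((cross i : ℝ) - thr j) + ∑ j ∈ range i, wt j * dev (thr j) b
      + (3 / 5 - cross i) ≤ gain (row (cutWt i)) b (3 / 5) := by
  have := le_gain_row_of_le (cutWt_nonneg i) (sum_le_one (cutWt_le i)) hb hc
    (cross_bounds' hi).1 (mix_cutWt_le hi) (cross_bounds' hi).2
  rw [sum_cutWt (by omega)] at this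
  simpa only [mul_add, sum_add_distrib] using this

lemma sum_tanVal_le {i n : ℕ} (hn : n ≤ 12) {p q : ℚ} {b l : ℝ}
    (h0 : 0 ≤ (1 - l) * p + l * q) (hb : (1 - l) * p + l * q ≤ b) :
    (1 - l) * ∑ j ∈ range n, (wt j : ℝ) * tanVal i j p +
      l * ∑ j ∈ range n, (wt j : ℝ) * tanVal i j q
      ≤ ∑ j ∈ range n, wt j * dev (thr j) b := by
  simp only [mul_sum, ← sum_add_distrib]
  refine sum_le_sum fun j hj => ?_
  have hj' : j < 12 := by have := mem_range.1 hj; omega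
  linarith [mul_le_mul_of_nonneg_left (tanVal_combo_le (i := i) hj' h0 hb) (wt_nonneg' hj')]

lemma log_le_div_sub_one {x y : ℝ} (hx : 0 < x) (hy : 0 < y) : 1 - x / y ≤ Real.log (y / x) := by
  have := Real.one_sub_inv_le_log_of_pos (div_pos hy hx)
  rwa [inv_div] at this

lemma le_mul_logTail_rho {b : ℝ} (hb : 0.55 ≤ b) : 0.3637 * b + b - 0.55 ≤ b * logTail rho b := by
  have h1 := logTail_sub_of_le rho_pos (by norm_num [rho] : (rho : ℝ) ≤ 0.55) hb
  have h2 := log_le_div_sub_one (by norm_num : (0 : ℝ) < 0.55) (by linarith : 0 < b)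
  have h3 : (0.3637 : ℝ) ≤ logTail rho 0.55 := by
    have h := logLo_le 4 (by norm_num [rho] : 1 ≤ 55 / 100 / rho)
    have hq : (3637 / 10000 : ℚ) ≤ logLo 4 (55 / 100 / rho) := by decide +kernel
    have hq' : ((3637 / 10000 : ℚ) : ℝ) ≤ logLo 4 (55 / 100 / rho) := by exact_mod_cast hq
    rw [logTail, max_eq_left (by norm_num [rho])]
    push_cast at h hq'
    norm_num at h hq' ⊢
    linarith
  have h4 : b * (1 - 0.55 / b) = b - 0.55 := by field_simp
  nlinarith [mul_le_mul_of_nonneg_left h2 (by linarith : (0:ℝ) ≤ b)]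

lemma cross_last : (cross 12 : ℝ) = 0.55454 := by norm_num [cross]

lemma one_fifth_le_gain_row {b : ℝ} (h0 : 0 ≤ b) (h1 : b ≤ 3 / 5) :
    1 / 5 ≤ gain (row (weight b)) b (3 / 5) := by
  rcases le_total b (2 / 5) with hb | hb
  · obtain ⟨i, hi, l, hl0, hl1, hbl, hr⟩ := exists_ramp_eq h0 hb
    have hw := weight_eq_combo hr
    have hA := continuous_row (cutWt i)
    have hB := continuous_row (cutWt (i + 1))
    have hg := gain_le_gain (continuous_row (weight b))
      (g := fun y => (1 - l) * row (cutWt i) y + l * row (cutWt (i + 1)) y)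
      (by fun_prop) h1 (fun y _ => row_combo_le hw hl0 hl1 y)
      (by rw [row_last (weight_nonneg b) (weight_le b), row_last (cutWt_nonneg _) (cutWt_le _),
        row_last (cutWt_nonneg _) (cutWt_le _)]; ring)
    rw [gain_add (by fun_prop) (by fun_prop), gain_const_mul, gain_const_mul] at hg
    have hk := (knot_lt' hi).le
    have hbk : b ≤ knot (i + 1) := by nlinarith
    obtain ⟨hc1, hc2⟩ := knot_le_cross i hi
    have hgA := le_gain_row_cutWt (i := i) (by omega) h0 (hbk.trans (by exact_mod_cast hc1))
    have hgB := le_gain_row_cutWt (i := i + 1) (by omega) h0 (hbk.trans (by exact_mod_cast hc2))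
    rw [sum_range_succ (fun j => (wt j : ℝ) * dev (thr j) b)] at hgB
    have hd := mul_nonneg (wt_nonneg' hi) (dev_nonneg (thr_pos' hi) h0)
    have hT := sum_tanVal_le (i := i) hi.le (h0.trans_eq hbl) hbl.ge
    have hL : ((1 / 5 : ℚ) : ℝ) ≤ _ := Rat.cast_le.2 (left_check i hi)
    have hR : ((1 / 5 : ℚ) : ℝ) ≤ _ := Rat.cast_le.2 (right_check i hi)
    push_cast at hL hR
    simp only [mul_add, sum_add_distrib] at hL
    have hl1' : 0 ≤ 1 - l := by linarith
    have h2 := mul_le_mul_of_nonneg_left hL hl1'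
    have h3 := mul_le_mul_of_nonneg_left hR hl0
    have h4 := mul_le_mul_of_nonneg_left hgA hl1'
    have h5 := mul_le_mul_of_nonneg_left hgB hl0
    have h6 := mul_nonneg hl0 hd
    linarith
  rcases le_total b (cross 12) with hbx | hbx
  · have hx := cross_bounds' (by norm_num : 12 < 13)
    have hg := le_gain_row_of_le (weight_nonneg b) (sum_le_one (weight_le b)) h0 hbx hx.1
      (mix_cross_last_le (weight_le b)) hx.2
    have hT := sum_tanVal_le (i := 12) (p := 2 / 5) (q := 2 / 5) (b := b) (l := 0) le_rfl
      (by norm_num) (by norm_num; linarith)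
    have hU : ((1 / 5 : ℚ) : ℝ) ≤ _ := Rat.cast_le.2 upper_check
    rw [sum_congr rfl fun j hj => by rw [weight_of_ge hb j (mem_range.1 hj)]] at hg
    push_cast at hU hT
    simp only [mul_add, sum_add_distrib] at hg hU
    linarith
  · rw [gain_congr h1 fun y hy => row_eq_of_cross_le (weight_nonneg b) (weight_le b)
      (hbx.trans hy.1), gain_logTail rho_pos h1, dev]
    rw [cross_last] at hbx
    have := le_mul_logTail_rho (b := b) (by linarith)
    rw [max_eq_left (by norm_num [rho] : (rho : ℝ) ≤ 3 / 5),
      max_eq_left (by norm_num [rho]; linarith : (rho : ℝ) ≤ b)]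
    linarith

/-! ### The price function -/

/-- The price function. -/
noncomputable def price (τ y : ℝ) : ℝ :=
  row (weight τ) (min y (3 / 5)) + (tot - marg (1 - max y (3 / 5)))

lemma last_bounds : 0.4507 ≤ logTail rho (3 / 5) ∧ logTail rho (3 / 5) ≤ 0.4508 := by
  have h1 := logLo_le 4 (by norm_num [rho] : 1 ≤ 3 / 5 / rho)
  have h2 := le_logHi 4 (by norm_num [rho] : 1 ≤ 3 / 5 / rho)
  have hq1 : (4507 / 10000 : ℚ) ≤ logLo 4 (3 / 5 / rho) := by decide +kernel
  have hq2 : logHi 4 (3 / 5 / rho) ≤ (4508 / 10000 : ℚ) := by decide +kernel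
  have hq1' : ((4507 / 10000 : ℚ) : ℝ) ≤ logLo 4 (3 / 5 / rho) := by exact_mod_cast hq1
  have hq2' : logHi 4 (3 / 5 / rho) ≤ ((4508 / 10000 : ℚ) : ℝ) := by exact_mod_cast hq2
  rw [logTail, max_eq_left (by norm_num [rho])]
  push_cast at h1 h2 hq1' hq2'
  norm_num at h1 h2 hq1' hq2' ⊢
  constructor <;> linarith

lemma row_weight_last (τ : ℝ) : row (weight τ) (3 / 5) = logTail rho (3 / 5) :=
  row_last (weight_nonneg τ) (weight_le τ)

lemma price_of_le (τ : ℝ) {y : ℝ} (h : y ≤ 3 / 5) : price τ y = row (weight τ) y := by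
  rw [price, min_eq_left h, max_eq_right h, marg_of_ge (by norm_num), sub_self, add_zero]

lemma price_of_ge (τ : ℝ) {y : ℝ} (h : 3 / 5 ≤ y) :
    price τ y = logTail rho (3 / 5) + tot - marg (1 - y) := by
  rw [price, min_eq_right h, max_eq_left h, row_weight_last, add_sub_assoc]

lemma price_mono (τ : ℝ) : Monotone (price τ) := fun _ _ h =>
  add_le_add (row_mono (weight_nonneg τ) (min_le_min_right _ h))
    (sub_le_sub_left (marg_mono (sub_le_sub_left (max_le_max_right _ h) 1)) _)

lemma price_mono_left (y : ℝ) : Monotone fun τ => price τ y := fun _ _ h =>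
  add_le_add_left (row_le_row (weight_mono h) _) _

lemma price_nonneg (τ y : ℝ) : 0 ≤ price τ y :=
  add_nonneg (row_nonneg _ _) (sub_nonneg.2 (marg_le _))

lemma price_le_one (τ y : ℝ) : price τ y ≤ 1 := by
  have h1 := row_mono (weight_nonneg τ) (min_le_right y (3 / 5))
  rw [row_weight_last] at h1
  have h2 := last_bounds.2
  have h3 := marg_nonneg (1 - max y (3 / 5))
  have h4 := tot_eq
  rw [price]
  linarith

lemma continuous_price : Continuous fun p : ℝ × ℝ => price p.1 p.2 := by
  have h1 : Continuous fun p : ℝ × ℝ => mix (weight p.1) (min p.2 (3 / 5)) :=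
    continuous_finsetSum _ fun j hj => ((continuous_weight j).comp continuous_fst).mul
      ((continuous_logTail_thr (mem_range.1 hj)).comp (continuous_snd.min continuous_const))
  have h2 := continuous_logTail_rho
  have h3 := continuous_marg
  unfold price row
  fun_prop

lemma continuous_price_right (τ : ℝ) : Continuous (price τ) :=
  continuous_price.comp (Continuous.prodMk_right τ)

/-! ### The contribution of large values -/

/-- The gain of the price function over `[3 / 5, 1 - b]`. -/
noncomputable def topGain (b : ℝ) : ℝ :=
  3 / 5 * tot - (1 - b) * marg b + ∫ y in b..2 / 5, marg y

lemma gain_price_of_le {a b c : ℝ} (h : b ≤ c) (hc : c ≤ 3 / 5) :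
    gain (price a) b c = gain (row (weight a)) b c :=
  gain_congr h fun _ hy => price_of_le a (hy.2.trans hc)

lemma gain_price_of_ge (τ : ℝ) {a θ : ℝ} (ha : 3 / 5 ≤ a) (h : a ≤ θ) :
    gain (price τ) a θ =
      a * (logTail rho (3 / 5) + tot) - θ * marg (1 - θ) + ∫ y in (1 - θ)..(1 - a), marg y := by
  have hc : Continuous fun y => marg (1 - y) := continuous_marg.comp (continuous_sub_left 1)
  rw [gain_congr h fun y hy => price_of_ge τ (ha.trans hy.1), gain,
    intervalIntegral.integral_sub (continuous_const.intervalIntegrable _ _)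
      (hc.intervalIntegrable _ _),
    intervalIntegral.integral_const, intervalIntegral.integral_comp_sub_left, smul_eq_mul]
  ring

lemma gain_price_of_le_of_ge {a θ : ℝ} (ha : a ≤ 3 / 5) (h : 3 / 5 ≤ θ) :
    gain (price a) a θ = gain (row (weight a)) a (3 / 5) + topGain (1 - θ) := by
  rw [gain_split (continuous_price_right a) a (3 / 5) θ, gain_price_of_le ha le_rfl,
    gain_price_of_ge a le_rfl h, price_of_le a le_rfl, row_weight_last, topGain]
  norm_num
  ring

lemma topGain_sub {b' b : ℝ} (h : b' ≤ b) :
    (1 - b) * (marg b - marg b') ≤ topGain b' - topGain b := by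
  have h1 : ∫ _ in b'..b, marg b' ≤ ∫ y in b'..b, marg y :=
    intervalIntegral.integral_mono_on h (continuous_const.intervalIntegrable _ _)
      (continuous_marg.intervalIntegrable _ _) fun y hy => marg_mono hy.1
  rw [intervalIntegral.integral_const, smul_eq_mul] at h1
  have h2 := intervalIntegral.integral_add_adjacent_intervals
    (continuous_marg.intervalIntegrable b' b) (continuous_marg.intervalIntegrable b (2 / 5))
    (μ := MeasureTheory.volume)
  rw [topGain, topGain]
  linarith

lemma le_topGain {b : ℝ} (h : b ≤ 2 / 5) : 3 / 5 * (tot - marg b) ≤ topGain b := by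
  have := topGain_sub h
  have h0 : topGain (2 / 5) = 0 := by
    rw [topGain, marg_of_ge le_rfl, intervalIntegral.integral_same]
    ring
  rw [h0, marg_of_ge le_rfl] at this
  linarith

lemma integral_ramp_of_ge {i : ℕ} (hi : i < 12) {b : ℝ} (hb : knot (i + 1) ≤ b) (h : b ≤ 2 / 5) :
    ∫ y in b..2 / 5, ramp i y = 2 / 5 - b := by
  rw [intervalIntegral.integral_congr (g := fun _ => (1 : ℝ))]
  · simp
  · intro y hy
    rw [Set.uIcc_of_le h] at hy
    exact ramp_of_ge hi (hb.trans hy.1)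

lemma le_integral_ramp {i : ℕ} (hi : i < 12) {l : ℝ} (hl1 : l ≤ 1) :
    (1 - l ^ 2) * (knot (i + 1) - knot i) / 2 + 2 / 5 - knot (i + 1) ≤
      ∫ y in ((1 - l) * knot i + l * knot (i + 1))..2 / 5, ramp i y := by
  have hd := sub_pos.2 (knot_lt' hi)
  set p : ℝ := ((knot i : ℚ) : ℝ)
  set q : ℝ := ((knot (i + 1) : ℚ) : ℝ)
  set b : ℝ := (1 - l) * p + l * q with hb
  have hbq : b ≤ q := by nlinarith
  have hq : q ≤ 2 / 5 := (knot_le hi le_rfl).trans knot_last.le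
  have hc := continuous_ramp i
  have h1 : ∫ y in b..q, (y - p) / (q - p) ≤ ∫ y in b..q, ramp i y := by
    refine intervalIntegral.integral_mono_on hbq
      ((by fun_prop : Continuous fun y => (y - p) / (q - p)).intervalIntegrable _ _)
      (hc.intervalIntegrable _ _) fun y hy => le_max_of_le_right (le_min ?_ le_rfl)
    rw [div_le_one hd]
    linarith [hy.2]
  have h2 : ∫ y in q..2 / 5, ramp i y = 2 / 5 - q := integral_ramp_of_ge hi le_rfl hq
  have h3 : ∫ y in b..q, (y - p) / (q - p) = (1 - l ^ 2) * (q - p) / 2 := by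
    rw [intervalIntegral.integral_div, intervalIntegral.integral_comp_sub_right fun y => y,
      integral_id, hb]
    field_simp
    ring
  have h4 := intervalIntegral.integral_add_adjacent_intervals
    (hc.intervalIntegrable b q) (hc.intervalIntegrable q (2 / 5)) (μ := MeasureTheory.volume)
  linarith

lemma le_integral_ramp_of_le {i : ℕ} (hi : i < 12) {b : ℝ} (hb : b ≤ knot i) :
    2 / 5 - ((knot i : ℝ) + knot (i + 1)) / 2 ≤ ∫ y in b..2 / 5, ramp i y := by
  have hc := continuous_ramp i
  have h1 := le_integral_ramp hi zero_le_one
  have h2 := intervalIntegral.integral_add_adjacent_intervals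
    (hc.intervalIntegrable b (knot i)) (hc.intervalIntegrable (knot i) (2 / 5))
    (μ := MeasureTheory.volume)
  have h3 : 0 ≤ ∫ y in b..knot i, ramp i y :=
    intervalIntegral.integral_nonneg hb fun y _ => ramp_nonneg i y
  norm_num at h1
  linarith

lemma integral_marg (a b : ℝ) : ∫ y in a..b, marg y =
    ∑ j ∈ range 12, wt j * ∫ y in a..b, ramp j y := by
  simp only [← intervalIntegral.integral_const_mul]
  exact intervalIntegral.integral_finsetSum fun j _ =>
    (continuous_weight j).intervalIntegrable _ _

lemma marg_eq_combo {i : ℕ} (hi : i < 12) {b l : ℝ}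
    (hr : ∀ j < 12, ramp j b = if j < i then 1 else if j = i then l else 0) :
    marg b = (1 - l) * cum i + l * cum (i + 1) := by
  have key {n : ℕ} (hn : n ≤ 12) : ∑ j ∈ range 12, cutWt n j = cum n := by
    simpa [cum] using sum_cutWt hn fun _ => 1
  rw [← key hi.le, ← key hi, mul_sum, mul_sum, ← sum_add_distrib]
  exact sum_congr rfl fun j hj => weight_eq_combo hr j (mem_range.1 hj)

lemma sub_le_topGain {b : ℝ} (h0 : 0 ≤ b) (h1 : b ≤ 2 / 5) : 2 / 5 - b ≤ topGain b := by
  obtain ⟨i, hi, l, hl0, hl1, hbl, hr⟩ := exists_ramp_eq h0 h1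
  have hm := marg_eq_combo hi hr
  have hl1' : 0 ≤ 1 - l := by linarith
  rcases slope_check i hi with ⟨hp, hq⟩ | ⟨hp, hq⟩
  · have hp' : (cum i : ℝ) ≤ knot i := by exact_mod_cast hp
    have hq' : (cum (i + 1) : ℝ) ≤ knot (i + 1) := by exact_mod_cast hq
    have hmb : marg b ≤ b := by
      rw [hm, hbl]
      gcongr
    have ht : ((2 / 5 - 3 / 5 * tot : ℚ) : ℝ) ≤ _ := Rat.cast_le.2 total_check
    push_cast at ht
    have hI : ∑ j ∈ range 12, (wt j : ℝ) * (2 / 5 - (knot j + knot (j + 1)) / 2) ≤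
        ∫ y in (0 : ℝ)..2 / 5, marg y := by
      rw [integral_marg]
      refine sum_le_sum fun j hj => mul_le_mul_of_nonneg_left (le_integral_ramp_of_le
        (mem_range.1 hj) ?_) (wt_nonneg' (mem_range.1 hj))
      rw [← knot_zero]
      exact knot_le (Nat.zero_le j) (mem_range.1 hj).le
    have h2 := intervalIntegral.integral_add_adjacent_intervals
      (continuous_marg.intervalIntegrable 0 b) (continuous_marg.intervalIntegrable b (2 / 5))
      (μ := MeasureTheory.volume)
    have h3 : ∫ y in (0 : ℝ)..b, marg y ≤ ∫ _ in (0 : ℝ)..b, marg b :=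
      intervalIntegral.integral_mono_on h0 (continuous_marg.intervalIntegrable _ _)
        (continuous_const.intervalIntegrable _ _) fun y hy => marg_mono hy.2
    rw [intervalIntegral.integral_const, smul_eq_mul] at h3
    rw [topGain]
    linarith
  · have hp' : ((2 / 5 - knot i : ℚ) : ℝ) ≤ _ := Rat.cast_le.2 hp
    have hq' : ((2 / 5 - knot (i + 1) : ℚ) : ℝ) ≤ _ := Rat.cast_le.2 hq
    push_cast at hp' hq'
    have h2 := le_topGain h1
    have h3 := mul_le_mul_of_nonneg_left hp' hl1'
    have h4 := mul_le_mul_of_nonneg_left hq' hl0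
    rw [hm] at h2
    linarith

/-! ### Lower bounds for the gain of the price function -/

lemma le_gain_row_weight {a θ : ℝ} (h0 : 0 ≤ a) (h : a ≤ θ) (hθ : θ ≤ 3 / 5) :
    θ - 2 / 5 + θ * (row (weight a) θ - logTail rho θ) ≤ gain (row (weight a)) a θ := by
  have h1 := one_fifth_le_gain_row h0 (h.trans hθ)
  have h2 := gain_le_gain continuous_logTail_rho (continuous_row (weight a)) hθ
    (fun y _ => logTail_le_row _ y) (row_weight_last a).symm
  rw [gain_split (continuous_row _) a θ] at h1
  rw [gain_logTail rho_pos hθ, dev, max_eq_left (by norm_num [rho] : (rho : ℝ) ≤ 3 / 5)] at h2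
  linarith [le_max_left θ (rho : ℝ)]

lemma mul_logTail_sub_le {s t θ : ℝ} (hs : 0 ≤ s) (hst : s ≤ t) (ht : t ≤ θ) :
    s * (logTail rho θ - logTail rho t) ≤ θ - t := by
  rcases hs.eq_or_lt with rfl | hs
  · linarith
  have ht0 := hs.trans_le hst
  have h1 := logTail_sub_le_div rho_pos ht0 ht
  have h2 : t * ((θ - t) / t) = θ - t := by field_simp
  have h3 := logTail_mono rho_pos ht
  nlinarith

lemma le_gain_price_of_ge {τ a θ : ℝ} (ha : 3 / 5 ≤ a) (h : a ≤ θ) :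
    a * logTail rho (3 / 5) + topGain (1 - θ) ≤ gain (price τ) a θ := by
  have h1 : ∫ y in (1 - a)..2 / 5, marg y ≤ ∫ _ in (1 - a)..2 / 5, (tot : ℝ) :=
    intervalIntegral.integral_mono_on (by linarith) (continuous_marg.intervalIntegrable _ _)
      (continuous_const.intervalIntegrable _ _) fun y _ => marg_le y
  have h2 := intervalIntegral.integral_add_adjacent_intervals
    (continuous_marg.intervalIntegrable (1 - θ) (1 - a))
    (continuous_marg.intervalIntegrable (1 - a) (2 / 5)) (μ := MeasureTheory.volume)
  rw [intervalIntegral.integral_const, smul_eq_mul] at h1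
  rw [gain_price_of_ge τ ha h, topGain]
  linarith

lemma one_fifth_add_le_gain_price {a θ : ℝ} (h0 : 0 ≤ a) (h : a ≤ θ) (hθ : 3 / 5 ≤ θ) :
    1 / 5 + topGain (1 - θ) ≤ gain (price a) a θ := by
  rcases le_total a (3 / 5) with ha | ha
  · rw [gain_price_of_le_of_ge ha hθ]
    linarith [one_fifth_le_gain_row h0 ha]
  · have := le_gain_price_of_ge (τ := a) ha h
    nlinarith [last_bounds.1]

lemma sub_le_gain_price_sub {a θ s t : ℝ} (h0 : 0 ≤ a) (h : a ≤ θ) (hs : 0 ≤ s) (hst : s ≤ t)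
    (ht : t ≤ θ) (ht' : t ≤ 3 / 5) :
    t - 2 / 5 - s * logTail rho t ≤ gain (price a) a θ - s * price a θ := by
  rcases le_total θ (3 / 5) with hθ | hθ
  · rw [gain_price_of_le h hθ, price_of_le a hθ]
    have h1 := le_gain_row_weight h0 h hθ
    have h2 := mul_logTail_sub_le hs hst ht
    have h3 := mul_nonneg (by linarith : 0 ≤ θ - s)
      (sub_nonneg.2 (logTail_le_row (weight a) θ))
    linarith
  · rw [price_of_ge a hθ]
    have h1 := one_fifth_add_le_gain_price h0 h hθ
    have h2 := mul_logTail_sub_le hs hst ht'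
    have h3 := le_topGain (b := 1 - θ) (by linarith)
    have h4 := mul_nonneg (by linarith : 0 ≤ 3 / 5 - s) (sub_nonneg.2 (marg_le (1 - θ)))
    linarith

lemma topGain_sub_le_gain_price_sub {a θ s t : ℝ} (h0 : 0 ≤ a) (h : a ≤ θ) (hst : s ≤ t)
    (ht : t ≤ θ) (ht' : 3 / 5 ≤ t) :
    1 / 5 + topGain (1 - t) - s * (logTail rho (3 / 5) + tot - marg (1 - t)) ≤
      gain (price a) a θ - s * price a θ := by
  rw [price_of_ge a (ht'.trans ht)]
  have h1 := one_fifth_add_le_gain_price h0 h (ht'.trans ht)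
  have hle : 1 - θ ≤ 1 - t := by linarith
  have h2 := topGain_sub hle
  have h3 := mul_nonneg (by linarith : 0 ≤ t - s) (sub_nonneg.2 (marg_mono hle))
  linarith

lemma neg_mul_le_gain_price_sub {a θ s : ℝ} (h0 : 0 ≤ a) (h : a ≤ θ) (hs : 0 ≤ s)
    (hst : s ≤ θ) (hs' : s ≤ 3 / 5) :
    -(s * logTail rho (3 / 5)) ≤ gain (price a) a θ - s * price a θ := by
  have hc := continuous_price_right a
  have hm := price_mono a
  have hl := logTail_nonneg rho_pos (3 / 5)
  rcases le_total s a with hsa | hsa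
  · have h1 := mul_le_gain hc hm h
    have h2 := mul_le_mul_of_nonneg_right hsa (price_nonneg a θ)
    have h3 := mul_nonneg hs hl
    linarith
  · have h1 := mul_le_gain hc hm hst
    have h2 := mul_le_gain hc hm hsa
    have h3 : price a s ≤ logTail rho (3 / 5) := by
      rw [← row_weight_last a, ← price_of_le a le_rfl]
      exact hm hs'
    rw [gain_split hc a s θ]
    have h4 := mul_le_mul_of_nonneg_left h3 hs
    have h5 := mul_nonneg h0 (price_nonneg a s)
    linarith

lemma end_combo_le {i : ℕ} (hi : i < 12) {b l : ℝ} (hl0 : 0 ≤ l) (hl1 : l ≤ 1) (h0 : 0 ≤ b)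
    (h1 : b ≤ 2 / 5) (hbl : b = (1 - l) * knot i + l * knot (i + 1))
    (hr : ∀ j < 12, ramp j b = if j < i then 1 else if j = i then l else 0) {j : ℕ} (hj : j < 12) :
    (1 - l) * endL i j + l * endR i j ≤
      ramp j b * (b - thr j + dev (thr j) b) + ∫ y in b..2 / 5, ramp j y := by
  have hk := knot_lt' hi
  have hb0 : knot i ≤ b := by nlinarith
  have hb1 : b ≤ knot (i + 1) := by nlinarith
  rw [hr j hj]
  unfold endL endR
  rcases lt_trichotomy j i with h | rfl | h
  · rw [if_pos h, if_pos h, if_pos h,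
      integral_ramp_of_ge hj ((knot_le (Nat.succ_le_of_lt h) hi.le).trans hb0) h1]
    have := tanVal_combo_le (i := i) hj (h0.trans_eq hbl) hbl.ge
    push_cast
    linarith
  · rw [if_neg (lt_irrefl j), if_neg (lt_irrefl j), if_neg (lt_irrefl j), if_pos rfl, if_pos rfl,
      if_pos rfl]
    have h2 := le_integral_ramp hj hl1
    rw [← hbl] at h2
    have h3 := mul_nonneg hl0 (dev_nonneg (thr_pos' hj) h0)
    have h4 := mul_nonneg (sq_nonneg (l - rpt j)) (sub_pos.2 hk).le
    push_cast
    have h5 : l * b = l * ((1 - l) * knot j + l * knot (j + 1)) := by rw [← hbl]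
    linarith
  · rw [if_neg (by omega), if_neg (by omega), if_neg (by omega), if_neg (by omega),
      if_neg (by omega), if_neg (by omega)]
    have h2 := le_integral_ramp_of_le hj (hb1.trans (knot_le (Nat.succ_le_of_lt h) hj.le))
    push_cast
    linarith

lemma two_fifths_le_topGain_add {b : ℝ} (h0 : 0 ≤ b) (h1 : b ≤ 2 / 5) :
    2 / 5 ≤ 3 / 5 * tot + ∑ j ∈ range 12, weight b j * (b - thr j + dev (thr j) b)
      + ∫ y in b..2 / 5, marg y := by
  obtain ⟨i, hi, l, hl0, hl1, hbl, hr⟩ := exists_ramp_eq h0 h1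
  obtain ⟨hL, hR⟩ := end_check i hi
  have hL' : ((2 / 5 - 3 / 5 * tot : ℚ) : ℝ) ≤ _ := Rat.cast_le.2 hL
  have hR' : ((2 / 5 - 3 / 5 * tot : ℚ) : ℝ) ≤ _ := Rat.cast_le.2 hR
  push_cast at hL' hR'
  have h2 : (1 - l) * ∑ j ∈ range 12, (wt j : ℝ) * endL i j +
      l * ∑ j ∈ range 12, (wt j : ℝ) * endR i j ≤
        ∑ j ∈ range 12, weight b j * (b - thr j + dev (thr j) b) + ∫ y in b..2 / 5, marg y := by
    rw [integral_marg, mul_sum, mul_sum, ← sum_add_distrib, ← sum_add_distrib]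
    refine sum_le_sum fun j hj => ?_
    have hj' := mem_range.1 hj
    have := mul_le_mul_of_nonneg_left (end_combo_le hi hl0 hl1 h0 h1 hbl hr hj') (wt_nonneg' hj')
    rw [weight]
    linarith
  have h3 := mul_le_mul_of_nonneg_left hL' (by linarith : 0 ≤ 1 - l)
  have h4 := mul_le_mul_of_nonneg_left hR' hl0
  linarith

lemma le_gain_price_add {b c : ℝ} (hb : b ≤ 3 / 5) (hc : 3 / 5 ≤ c) (hc1 : c ≤ 1) :
    gain (row (weight b)) b (3 / 5) + (c - 3 / 5) ≤ gain (price b) b c := by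
  rw [gain_price_of_le_of_ge hb hc]
  linarith [sub_le_topGain (b := 1 - c) (by linarith) (by linarith)]

lemma le_gain_pair_of_le {a θ b c : ℝ} (ha : 0 ≤ a) (hθ : a ≤ θ) (hb0 : 0 ≤ b) (hb : b ≤ 2 / 5)
    (ht : 1 - b ≤ θ) (h : b ≤ c) (hc1 : c ≤ 1) :
    3 / 5 ≤ gain (price a) a θ + gain (price b) b c + (1 - price a θ) * (1 - c) := by
  have h1 := topGain_sub_le_gain_price_sub (s := 1 - c) ha hθ (by linarith) ht (by linarith)
  rw [sub_sub_cancel] at h1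
  have hl := last_bounds.2
  have ht := tot_eq
  have h2 := mul_nonneg (by linarith : 0 ≤ 1 - c)
    (by linarith : 0 ≤ 1 - logTail rho (3 / 5) - tot)
  rcases le_total c (3 / 5) with hc | hc
  · rw [gain_price_of_le h hc]
    have h3 := le_gain_row (weight_nonneg b) (sum_le_one (weight_le b)) hb0 h
    have h4 := two_fifths_le_topGain_add hb0 hb
    have h5 : ∑ j ∈ range 12, weight b j * (c - thr j + dev (thr j) b) =
        ∑ j ∈ range 12, weight b j * (b - thr j + dev (thr j) b) + marg b * (c - b) := by
      rw [marg, sum_mul, ← sum_add_distrib]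
      exact sum_congr rfl fun j _ => by ring
    rw [topGain] at h1
    linarith
  · have h3 := le_gain_price_add (b := b) (by linarith) hc hc1
    have h4 := one_fifth_le_gain_row hb0 (by linarith)
    have h5 := le_topGain hb
    have h6 := mul_nonneg (by linarith : 0 ≤ c - 2 / 5) (sub_nonneg.2 (marg_le b))
    rw [ht] at h1 h2 h5 h6
    linarith

lemma logTail_rho_le_line {t : ℝ} (ht : rho ≤ t) :
    logTail rho t ≤ 50 / 29 * t - 0.5831 := by
  have hv : logTail rho 0.58 ≤ 0.4169 := by
    have h := le_logHi 4 (by norm_num [rho] : 1 ≤ 58 / 100 / rho)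
    have hq : logHi 4 (58 / 100 / rho) ≤ (4169 / 10000 : ℚ) := by decide +kernel
    have hq' : (logHi 4 (58 / 100 / rho) : ℝ) ≤ ((4169 / 10000 : ℚ) : ℝ) := by exact_mod_cast hq
    rw [logTail, max_eq_left (by norm_num [rho])]
    push_cast at h hq'
    norm_num at h hq' ⊢
    linarith
  have ht0 := rho_pos.trans_le ht
  rcases le_total t 0.58 with h | h
  · have h1 := logTail_sub_of_le rho_pos ht h
    have h2 := log_le_div_sub_one ht0 (by norm_num : (0 : ℝ) < 0.58)
    have h3 : t / 0.58 = 50 / 29 * t := by ring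
    linarith
  · have h1 := logTail_sub_le_div rho_pos (by norm_num) h
    have h3 : (t - 0.58) / 0.58 = 50 / 29 * t - 1 := by ring
    linarith

lemma logTail_rho_le {t : ℝ} (ht : rho ≤ t) : logTail rho t ≤ (t - rho) / rho := by
  simpa [logTail_of_le rho_pos le_rfl] using logTail_sub_le_div rho_pos rho_pos ht

lemma le_sum_wt_mul {b : ℝ} (h0 : 2 / 5 ≤ b) (h1 : b ≤ cross 12) :
    0.1607 + 0.23 * (b - 0.4) ≤ ∑ j ∈ range 12, wt j * (cross 12 - thr j + dev (thr j) b) := by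
  have hx := cross_last
  have hd : (0 : ℝ) < cross 12 - 2 / 5 := by rw [hx]; norm_num
  have hq : (0.1607 : ℚ) ≤ ∑ j ∈ range 12, wt j * (cross 12 - thr j + tanVal 12 j (2 / 5)) ∧
      (0.1963 : ℚ) ≤ ∑ j ∈ range 12, wt j * (cross 12 - thr j + tanVal 12 j (cross 12)) := by
    decide +kernel
  have hL : ((0.1607 : ℚ) : ℝ) ≤ _ := Rat.cast_le.2 hq.1
  have hR : ((0.1963 : ℚ) : ℝ) ≤ _ := Rat.cast_le.2 hq.2
  push_cast at hL hR
  set l : ℝ := (b - 2 / 5) / (cross 12 - 2 / 5) with hl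
  have hl0 : 0 ≤ l := div_nonneg (by linarith) hd.le
  have hl1 : l ≤ 1 := by rw [hl, div_le_one hd]; linarith
  have hbl : (1 - l) * (2 / 5 : ℚ) + l * cross 12 = b := by
    have := div_mul_cancel₀ (b - 2 / 5) hd.ne'
    rw [← hl] at this
    push_cast
    linarith
  have hT := sum_tanVal_le (i := 12) le_rfl (by rw [hbl]; linarith) hbl.le
  push_cast at hbl
  rw [hx] at hbl
  simp only [mul_add, sum_add_distrib] at hL hR ⊢
  have h3 := mul_le_mul_of_nonneg_left hL (by linarith : 0 ≤ 1 - l)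
  have h4 := mul_le_mul_of_nonneg_left hR hl0
  norm_num at h3 h4 ⊢
  linarith

lemma le_gain_pair_of_ge_of_le {a θ b c : ℝ} (ha : 0 ≤ a) (hθ : a ≤ θ) (hb : 2 / 5 ≤ b)
    (hbx : b ≤ cross 12) (ht : 1 - b ≤ θ) (h : b ≤ c) (hc1 : c ≤ 1) :
    3 / 5 ≤ gain (price a) a θ + gain (price b) b c + (1 - price a θ) * (1 - c) := by
  have hx := cross_last
  have h1 := sub_le_gain_price_sub (s := 1 - c) ha hθ (by linarith) (by linarith) ht (by linarith)
  have hP := logTail_rho_le_line (t := 1 - b) (by norm_num [rho]; linarith)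
  have hP0 := logTail_nonneg rho_pos (1 - b)
  have hPl := logTail_mono rho_pos (by linarith : 1 - b ≤ 3 / 5)
  have hl := last_bounds.2
  have hV := le_sum_wt_mul hb hbx
  have ht := tot_eq
  have hb0 : 0 ≤ b := by linarith
  have hw := weight_of_ge hb
  obtain ⟨hx1, hx2⟩ := cross_bounds' (by norm_num : 12 < 13)
  rcases le_total c (cross 12) with hc | hc
  · rw [gain_price_of_le h (hc.trans hx2)]
    have h3 := le_gain_row (weight_nonneg b) (sum_le_one (weight_le b)) hb0 h
    have h4 : ∑ j ∈ range 12, weight b j * (c - thr j + dev (thr j) b) =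
        ∑ j ∈ range 12, wt j * (cross 12 - thr j + dev (thr j) b) - tot * (cross 12 - c) := by
      rw [← sum_wt, sum_mul, ← sum_sub_distrib]
      exact sum_congr rfl fun j hj => by rw [hw j (mem_range.1 hj)]; ring
    have h5 := mul_nonneg (sub_nonneg.2 hc)
      (by linarith : 0 ≤ 1 - logTail rho (1 - b) - tot)
    rw [hx] at h4 h5 hV
    rw [ht] at h4 h5
    linarith
  · have h3 : ∑ j ∈ range 12, wt j * (cross 12 - thr j + dev (thr j) b) + (c - cross 12) ≤
        gain (price b) b c := by
      have key {d : ℝ} (hd : cross 12 ≤ d) :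
          ∑ j ∈ range 12, wt j * (cross 12 - thr j + dev (thr j) b) + (d - cross 12) ≤
            gain (row (weight b)) b d := by
        have := le_gain_row_of_le (weight_nonneg b) (sum_le_one (weight_le b)) hb0 hbx hx1
          (mix_cross_last_le (weight_le b)) hd
        rwa [sum_congr rfl fun j hj => by rw [hw j (mem_range.1 hj)]] at this
      rcases le_total c (3 / 5) with hc' | hc'
      · rw [gain_price_of_le h hc']
        exact key hc
      · linarith [le_gain_price_add (hbx.trans hx2) hc' hc1, key hx2]
    have h5 := mul_nonneg (sub_nonneg.2 hc) hP0
    rw [hx] at h3 h5 hV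
    linarith

lemma le_gain_pair_of_cross_le {a θ b c : ℝ} (ha : 0 ≤ a) (hθ : a ≤ θ) (hbx : cross 12 ≤ b)
    (hb : b ≤ 3 / 5) (ht : 1 - b ≤ θ) (h : b ≤ c) (hc1 : c ≤ 1) :
    3 / 5 ≤ gain (price a) a θ + gain (price b) b c + (1 - price a θ) * (1 - c) := by
  have hx := cross_last
  have h1 := sub_le_gain_price_sub (s := 1 - c) ha hθ (by linarith) (by linarith) ht (by linarith)
  have hr : (rho : ℝ) = 0.382271 := by norm_num [rho]
  have hP0 := logTail_nonneg rho_pos (1 - b)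
  have hP : logTail rho (1 - b) ≤ 0.1655 := by
    refine (logTail_mono rho_pos (by linarith : 1 - b ≤ 0.44546)).trans
      ((logTail_rho_le (by norm_num [rho])).trans ?_)
    norm_num [rho]
  have hg := le_mul_logTail_rho (b := b) (by linarith)
  have key {d : ℝ} (hd : b ≤ d) : gain (row (weight b)) b d = b * logTail rho b + (d - b) := by
    rw [gain_row_of_le (weight_nonneg b) (sum_le_one (weight_le b)) b
      ((cross_bounds' (by norm_num)).1.trans hbx) _ hd, gain_self,
      row_eq_of_cross_le (weight_nonneg b) (weight_le b) hbx]
    have := mix_sub_le (weight_nonneg b) (sum_le_one (weight_le b))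
      (cross_bounds' (by norm_num)).1 hbx
    linarith [mix_cross_last_le (weight_le b)]
  have h3 : b * logTail rho b + (c - b) ≤ gain (price b) b c := by
    rcases le_total c (3 / 5) with hc | hc
    · rw [gain_price_of_le h hc, key h]
    · linarith [le_gain_price_add hb hc hc1, key hb]
  have h4 := mul_nonneg (sub_nonneg.2 h) hP0
  have h5 := mul_le_mul_of_nonneg_left hP (by linarith : 0 ≤ 1 - b)
  linarith

lemma le_gain_pair_of_ge {a θ b c : ℝ} (ha : 0 ≤ a) (hθ : a ≤ θ) (hb : 3 / 5 ≤ b)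
    (ht : 1 - b ≤ θ) (h : b ≤ c) (hc1 : c ≤ 1) :
    3 / 5 ≤ gain (price a) a θ + gain (price b) b c + (1 - price a θ) * (1 - c) := by
  have hl := last_bounds.1
  have hl' := last_bounds.2
  have h2 := le_gain_price_of_ge (τ := b) hb h
  have h3 := sub_le_topGain (b := 1 - c) (by linarith) (by linarith)
  have h4 := mul_le_mul_of_nonneg_left hl (by linarith : 0 ≤ b)
  rcases le_total b 0.725 with hb' | hb'
  · have h1 := sub_le_gain_price_sub (s := 1 - c) ha hθ (by linarith) (by linarith) ht
      (by linarith)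
    rcases le_total (1 - b) rho with hr | hr
    · rw [logTail_of_le rho_pos hr] at h1
      linarith
    · have hP : logTail rho (1 - b) ≤ 0.05 := by
        refine (logTail_mono rho_pos (by linarith : 1 - b ≤ 0.4)).trans
          ((logTail_rho_le (by norm_num [rho])).trans ?_)
        norm_num [rho]
      norm_num [rho] at hr
      have h5 := mul_le_mul_of_nonneg_left hP (by linarith : 0 ≤ 1 - c)
      linarith
  · have h1 := neg_mul_le_gain_price_sub (s := 1 - c) ha hθ (by linarith) (by linarith)
      (by linarith)
    have h5 := mul_le_mul_of_nonneg_left hl' (by linarith : 0 ≤ 1 - c)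
    linarith

lemma le_gain_pair {a θ b c : ℝ} (ha : 0 ≤ a) (hθ : a ≤ θ) (hθ1 : θ ≤ 1) (ht : 1 - θ ≤ b)
    (h : b ≤ c) (hc1 : c ≤ 1) :
    3 / 5 ≤ gain (price a) a θ + gain (price b) b c + (1 - price a θ) * (1 - c) := by
  have ht' : 1 - b ≤ θ := by linarith
  rcases le_total b (2 / 5) with hb | hb
  · exact le_gain_pair_of_le ha hθ (by linarith) hb ht' h hc1
  rcases le_total b (cross 12) with hbx | hbx
  · exact le_gain_pair_of_ge_of_le ha hθ hb hbx ht' h hc1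
  rcases le_total b (3 / 5) with hb' | hb'
  · exact le_gain_pair_of_cross_le ha hθ hbx hb' ht' h hc1
  · exact le_gain_pair_of_ge ha hθ hb' ht' h hc1

lemma le_gain_single {b c : ℝ} (h0 : 0 ≤ b) (h : b ≤ c) (hc1 : c ≤ 1) :
    3 / 5 ≤ gain (price b) b c + 1 - c := by
  rcases le_total c (3 / 5) with hc | hc
  · rw [gain_price_of_le h hc]
    have h1 := le_gain_row_weight h0 h hc
    have h2 := mul_nonneg (h0.trans h) (sub_nonneg.2 (logTail_le_row (weight b) c))
    linarith
  · linarith [one_fifth_add_le_gain_price h0 h hc,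
      sub_le_topGain (b := 1 - c) (by linarith) (by linarith)]

end PriceFunction

theorem exists_good_h :
    ∃ h : ℝ → ℝ → ℝ,
      (∀ τ ∈ Set.Icc (0:ℝ) 1, ∀ θ ∈ Set.Icc (0:ℝ) 1, h τ θ ∈ Set.Icc (0:ℝ) 1) ∧
      ContinuousOn (fun p : ℝ × ℝ => h p.1 p.2) (Set.Icc 0 1 ×ˢ Set.Icc 0 1) ∧
      (∀ θ ∈ Set.Icc (0:ℝ) 1, MonotoneOn (fun τ => h τ θ) (Set.Icc 0 1)) ∧
      (∀ τ ∈ Set.Icc (0:ℝ) 1, MonotoneOn (fun θ => h τ θ) (Set.Icc 0 1)) ∧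
      (∀ τv θv : ℝ, 0 ≤ τv → τv ≤ θv → θv ≤ 1 →
        (0.6 : ℝ) ≤ θv * h τv θv - (∫ y in τv..θv, h τv y) + 1 - θv) ∧
      (∀ τu θu τv θv : ℝ, 0 ≤ τu → τu ≤ θu → θu ≤ 1 →
        1 - θu ≤ τv → τv ≤ θv → θv ≤ 1 →
        (0.6 : ℝ) ≤ θu * h τu θu - (∫ y in τu..θu, h τu y)
          + θv * h τv θv - (∫ y in τv..θv, h τv y)
          + (1 - h τu θu) * (1 - θv)) := by
  refine ⟨PriceFunction.price,
    fun τ _ θ _ => ⟨PriceFunction.price_nonneg τ θ, PriceFunction.price_le_one τ θ⟩,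
    PriceFunction.continuous_price.continuousOn,
    fun θ _ => (PriceFunction.price_mono_left θ).monotoneOn _,
    fun τ _ => (PriceFunction.price_mono τ).monotoneOn _,
    fun τv θv h0 h h1 => ?_, fun τu θu τv θv hu0 hu hu1 ht hv hv1 => ?_⟩
  · have := PriceFunction.le_gain_single h0 h h1
    rw [PriceFunction.gain] at this
    norm_num
    linarith
  · have := PriceFunction.le_gain_pair hu0 hu hu1 ht hv hv1
    rw [PriceFunction.gain, PriceFunction.gain] at this
    norm_num
    linarith
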